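/- Let K carry a recurrence structure with projection matrix B and set of invariant measures P*. For every p ∈ Δ(K) there exists an affine map f : P* → Δ(K) such that f(pB) = p and f(p')B = p' for every p' ∈ P*. -/

import Mathlib

/-- The `L¹` distance between two vectors indexed by a finite set. -/
noncomputable def dist1 {S : Type*} [Fintype S] (p p' : S → ℝ) : ℝ :=
  ∑ k, |p k - p' k|

/-- Row-vector times matrix multiplication, `(p A) k' = ∑ k, p k * A k k'`. -/
noncomputable def vecMulF {K : Type*} [Fintype K] (p : K → ℝ) (A : K → K → ℝ) : K → ℝ :=
  fun k' => ∑ k, p k * A k k'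

/-- A recurrence structure on a finite set `K`: a partition of `K` into `R` nonempty
classes (given by the class map `cls`, surjectivity expressing nonemptiness of classes),
together with, for each class `r`, a probability vector `pstar r ∈ Δ(K)` supported
in the class `r`. -/
structure RecStruct (K : Type*) [Fintype K] (R : ℕ) where
  cls : K → Fin R
  cls_surj : Function.Surjective cls
  pstar : Fin R → K → ℝ
  pstar_mem : ∀ r, pstar r ∈ stdSimplex ℝ K
  pstar_supp : ∀ r k, pstar r k ≠ 0 → cls k = r

namespace RecStruct

variable {K : Type*} [Fintype K] {R : ℕ}

/-- `lam rs p r` is the total mass given by `p` to the recurrence class `r`. -/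
noncomputable def lam (rs : RecStruct K R) (p : K → ℝ) : Fin R → ℝ :=
  fun r => ∑ k, if rs.cls k = r then p k else 0

/-- The conditional law of `p` given the recurrence class `r` (equal to `pstar r` when the
class has zero mass under `p`). -/
noncomputable def cond (rs : RecStruct K R) (p : K → ℝ) (r : Fin R) : K → ℝ :=
  if 0 < rs.lam p r then (fun k => if rs.cls k = r then p k / rs.lam p r else 0)
  else rs.pstar r

/-- The quantity `S(p,p') = ‖λ(p) - λ(p')‖₁ + ∑_{r : λ(p)^r λ(p')^r > 0} λ(p')^r ‖p_{|r} - p'_{|r}‖₁`. -/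
noncomputable def Sdist (rs : RecStruct K R) (p p' : K → ℝ) : ℝ :=
  dist1 (rs.lam p) (rs.lam p') +
    ∑ r, if 0 < rs.lam p r * rs.lam p' r
      then rs.lam p' r * dist1 (rs.cond p r) (rs.cond p' r) else 0

/-- The projection matrix `B`, whose row `k` is `pstar r` where `r` is the class of `k`. -/
noncomputable def Bmat (rs : RecStruct K R) : K → K → ℝ :=
  fun k k' => rs.pstar (rs.cls k) k'

/-- `P*`, the convex hull of the invariant measures of the classes. -/
noncomputable def Pset (rs : RecStruct K R) : Set (K → ℝ) :=
  convexHull ℝ (Set.range rs.pstar)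

/-- `B^{-1}(p*) = {p ∈ Δ(K) : pB = p*}`. -/
def Binv (rs : RecStruct K R) (pst : K → ℝ) : Set (K → ℝ) :=
  {p | p ∈ stdSimplex ℝ K ∧ vecMulF p rs.Bmat = pst}

/-- A stochastic matrix on `K` compatible with the recurrence structure: it is block
diagonal with respect to the partition and each `pstar r` is invariant. -/
structure IsCompatible (rs : RecStruct K R) (M : K → K → ℝ) : Prop where
  nonneg : ∀ k k', 0 ≤ M k k'
  rowSum : ∀ k, ∑ k', M k k' = 1
  block : ∀ k k', rs.cls k ≠ rs.cls k' → M k k' = 0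
  invariant : ∀ r, vecMulF (rs.pstar r) M = rs.pstar r

end RecStruct

namespace RecStruct

variable {K : Type*} [Fintype K] {R : ℕ}

/-- The vector with mass `w r` on the class `r`, distributed according to `q r`. -/
def blend (rs : RecStruct K R) (q : Fin R → K → ℝ) (w : Fin R → ℝ) : K → ℝ :=
  fun k => w (rs.cls k) * q (rs.cls k) k

theorem sum_lam (rs : RecStruct K R) (p : K → ℝ) : ∑ r, rs.lam p r = ∑ k, p k := by
  simp only [lam]
  rw [Finset.sum_comm]
  simp

theorem lam_combo (rs : RecStruct K R) (a b : ℝ) (p q : K → ℝ) :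
    rs.lam (a • p + b • q) = a • rs.lam p + b • rs.lam q := by
  ext r
  simp only [lam, Pi.add_apply, Pi.smul_apply, smul_eq_mul, Finset.mul_sum,
    ← Finset.sum_add_distrib]
  refine Finset.sum_congr rfl fun k _ => ?_
  split_ifs <;> simp

theorem lam_nonneg (rs : RecStruct K R) {p : K → ℝ} (hp : ∀ k, 0 ≤ p k) (r : Fin R) :
    0 ≤ rs.lam p r :=
  Finset.sum_nonneg fun k _ => by split_ifs <;> simp [hp k]

theorem lam_mem_stdSimplex (rs : RecStruct K R) {p : K → ℝ} (hp : p ∈ stdSimplex ℝ K) :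
    rs.lam p ∈ stdSimplex ℝ (Fin R) :=
  ⟨rs.lam_nonneg hp.1, by rw [sum_lam, hp.2]⟩

theorem lam_of_support (rs : RecStruct K R) {q : K → ℝ} {r : Fin R}
    (hq : ∀ k, q k ≠ 0 → rs.cls k = r) : rs.lam q r = ∑ k, q k := by
  refine Finset.sum_congr rfl fun k _ => ?_
  split_ifs with h
  · rfl
  · by_contra h0
    exact h (hq k (Ne.symm h0))

theorem blend_combo (rs : RecStruct K R) (q : Fin R → K → ℝ) (a b : ℝ) (v w : Fin R → ℝ) :
    rs.blend q (a • v + b • w) = a • rs.blend q v + b • rs.blend q w := by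
  ext k
  simp only [blend, Pi.add_apply, Pi.smul_apply, smul_eq_mul]
  ring

theorem lam_blend (rs : RecStruct K R) {q : Fin R → K → ℝ}
    (hq : ∀ r, q r ∈ stdSimplex ℝ K) (hs : ∀ r k, q r k ≠ 0 → rs.cls k = r)
    (w : Fin R → ℝ) : rs.lam (rs.blend q w) = w := by
  ext r
  have h : rs.lam (rs.blend q w) r = w r * rs.lam (q r) r := by
    simp only [lam, blend, Finset.mul_sum]
    refine Finset.sum_congr rfl fun k _ => ?_
    split_ifs with h
    · rw [h]
    · simp
  rw [h, rs.lam_of_support (hs r), (hq r).2, mul_one]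

theorem blend_mem_stdSimplex (rs : RecStruct K R) {q : Fin R → K → ℝ}
    (hq : ∀ r, q r ∈ stdSimplex ℝ K) (hs : ∀ r k, q r k ≠ 0 → rs.cls k = r)
    {w : Fin R → ℝ} (hw : w ∈ stdSimplex ℝ (Fin R)) : rs.blend q w ∈ stdSimplex ℝ K :=
  ⟨fun k => mul_nonneg (hw.1 _) ((hq _).1 k), by
    rw [← rs.sum_lam, rs.lam_blend hq hs, hw.2]⟩

theorem vecMulF_Bmat (rs : RecStruct K R) (p : K → ℝ) :
    vecMulF p rs.Bmat = rs.blend rs.pstar (rs.lam p) := by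
  ext k'
  simp only [vecMulF, Bmat, blend, lam, Finset.sum_mul]
  refine Finset.sum_congr rfl fun k _ => ?_
  split_ifs with h
  · rw [h]
  · have : rs.pstar (rs.cls k) k' = 0 := by
      by_contra h0
      exact h (rs.pstar_supp _ _ h0).symm
    simp [this]

theorem cond_support (rs : RecStruct K R) (p : K → ℝ) (r : Fin R) (k : K)
    (h : rs.cond p r k ≠ 0) : rs.cls k = r := by
  unfold cond at h
  split_ifs at h with h0
  · by_contra hk
    simp [hk] at h
  · exact rs.pstar_supp r k h

theorem cond_mem_stdSimplex (rs : RecStruct K R) {p : K → ℝ} (hp : ∀ k, 0 ≤ p k)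
    (r : Fin R) : rs.cond p r ∈ stdSimplex ℝ K := by
  unfold cond
  split_ifs with h
  · refine ⟨fun k => ?_, ?_⟩
    · dsimp only
      split_ifs
      · exact div_nonneg (hp k) h.le
      · exact le_rfl
    · have : ∑ k, (if rs.cls k = r then p k / rs.lam p r else 0) =
          rs.lam p r / rs.lam p r := by
        conv_rhs => enter [1]; unfold lam
        rw [Finset.sum_div]
        refine Finset.sum_congr rfl fun k _ => ?_
        split_ifs <;> simp
      rw [this, div_self h.ne']
  · exact rs.pstar_mem r

theorem blend_cond_lam (rs : RecStruct K R) {p : K → ℝ} (hp : ∀ k, 0 ≤ p k) :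
    rs.blend (rs.cond p) (rs.lam p) = p := by
  ext k
  simp only [blend, cond]
  split_ifs with h
  · simp [mul_div_cancel₀ _ h.ne']
  · have h0 : rs.lam p (rs.cls k) = 0 := le_antisymm (not_lt.1 h) (rs.lam_nonneg hp _)
    have hk : p k ≤ rs.lam p (rs.cls k) := by
      have := Finset.single_le_sum (f := fun j => if rs.cls j = rs.cls k then p j else 0)
        (fun j _ => by split_ifs <;> simp [hp j]) (Finset.mem_univ k)
      simpa [lam] using this
    rw [h0, zero_mul]
    exact le_antisymm (hp k) (h0 ▸ hk)

theorem Pset_subset_stdSimplex (rs : RecStruct K R) : rs.Pset ⊆ stdSimplex ℝ K :=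
  convexHull_min (Set.range_subset_iff.2 rs.pstar_mem) (convex_stdSimplex ℝ K)

theorem vecMulF_Bmat_of_mem_Pset (rs : RecStruct K R) {p : K → ℝ} (hp : p ∈ rs.Pset) :
    vecMulF p rs.Bmat = p := by
  rw [vecMulF_Bmat]
  have hsub : rs.Pset ⊆ {q | rs.blend rs.pstar (rs.lam q) = q} := by
    refine convexHull_min ?_ ?_
    · rintro _ ⟨r, rfl⟩
      ext k
      simp only [blend]
      by_cases h : rs.cls k = r
      · rw [h, rs.lam_of_support (rs.pstar_supp r), (rs.pstar_mem r).2, one_mul]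
      · have h0 : rs.pstar r k = 0 := by_contra fun h' => h (rs.pstar_supp r k h')
        have : rs.lam (rs.pstar r) (rs.cls k) = 0 := by
          refine Finset.sum_eq_zero fun j _ => ?_
          split_ifs with hj
          · exact by_contra fun h' => h (hj.symm.trans (rs.pstar_supp r j h'))
          · rfl
        rw [this, h0, zero_mul]
    · intro x hx y hy a b _ _ _
      simp only [Set.mem_ofPred_eq] at hx hy ⊢
      rw [lam_combo, blend_combo, hx, hy]
  exact hsub hp

end RecStruct

/-- **Affine section of the projection `B` (step in Proposition `comparison`).**
For every `p ∈ Δ(K)` there is an affine map `f : P* → Δ(K)` with `f(pB) = p` and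
`f(p')B = p'` for every `p' ∈ P*`. -/
theorem exists_affine_section {K : Type*} [Fintype K] {R : ℕ}
    (rs : RecStruct K R) (p : K → ℝ) (hp : p ∈ stdSimplex ℝ K) :
    ∃ f : (K → ℝ) → (K → ℝ),
      (∀ p₁ ∈ rs.Pset, ∀ p₂ ∈ rs.Pset, ∀ θ : ℝ, 0 ≤ θ → θ ≤ 1 →
        f (θ • p₁ + (1 - θ) • p₂) = θ • f p₁ + (1 - θ) • f p₂) ∧
      (∀ p' ∈ rs.Pset, f p' ∈ stdSimplex ℝ K) ∧
      f (vecMulF p rs.Bmat) = p ∧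
      (∀ p' ∈ rs.Pset, vecMulF (f p') rs.Bmat = p') := by
  have hq := rs.cond_mem_stdSimplex hp.1
  have hs := rs.cond_support p
  refine ⟨fun p' => rs.blend (rs.cond p) (rs.lam p'), fun p₁ _ p₂ _ θ _ _ => ?_,
    fun p' hp' => ?_, ?_, fun p' hp' => ?_⟩
  · simp only [rs.lam_combo, rs.blend_combo]
  · exact rs.blend_mem_stdSimplex hq hs (rs.lam_mem_stdSimplex (rs.Pset_subset_stdSimplex hp'))
  · simp only [rs.vecMulF_Bmat, rs.lam_blend rs.pstar_mem rs.pstar_supp]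
    exact rs.blend_cond_lam hp.1
  · rw [rs.vecMulF_Bmat, rs.lam_blend hq hs, ← rs.vecMulF_Bmat, rs.vecMulF_Bmat_of_mem_Pset hp']
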